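/- Let n, m be positive integers and h > 0. Let f : ℝⁿ → ℝⁿ be continuous with ‖f(z)‖ ≤ M_f‖z‖ for all z ∈ ℝⁿ, let B₁ : ℝⁿ → ℝ^{n×m} be continuous with ‖B₁(z)‖ ≤ M_{B₁} for all z, and let B_int : [-h,0] × ℝⁿ → ℝ^{n×m} be continuous with ‖B_int(θ,z)‖ ≤ M_int for all θ ∈ [-h,0] and z ∈ ℝⁿ. Let φ : [-h,0] → ℝᵐ be continuous, let x ∈ ℝⁿ, and let ξ : [0,h] → ℝⁿ be a C¹ solution of the predictor ODE with ξ(0) = x, so that Y(x,φ) = ξ(h). Then ‖x‖² ≤ ρ²(‖Y(x,φ)‖² + ‖φ‖²), where ρ = √2 · e^{M_f h} · max{1, √h·(M_{B₁} + h·M_int)}. -/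

import Mathlib

open Real Set

/-- **Grönwall inequality with a continuous forcing term.** -/
theorem norm_le_exp_mul_add_integral_of_norm_deriv_right_le
    {E : Type*} [NormedAddCommGroup E] [NormedSpace ℝ E]
    {v v' : ℝ → E} {g : ℝ → ℝ} {K b : ℝ} (hK : 0 ≤ K) (hb : 0 ≤ b)
    (hg : Continuous g) (hg0 : ∀ t, 0 ≤ g t)
    (hv : ContinuousOn v (Icc 0 b))
    (hv' : ∀ t ∈ Ico 0 b, HasDerivWithinAt v (v' t) (Ici t) t)
    (bound : ∀ t ∈ Ico 0 b, ‖v' t‖ ≤ K * ‖v t‖ + g t) :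
    ‖v b‖ ≤ exp (K * b) * (‖v 0‖ + ∫ t in 0..b, g t) := by
  have key : ∀ ε > 0, ‖v b‖ ≤ exp (K * b) * (‖v 0‖ + (∫ t in 0..b, g t) + ε * b) := by
    intro ε hε
    have hB : ∀ t, HasDerivAt
        (fun t => exp (K * t) * (‖v 0‖ + (∫ τ in 0..t, g τ) + ε * t))
        (K * (exp (K * t) * (‖v 0‖ + (∫ τ in 0..t, g τ) + ε * t))
          + exp (K * t) * (g t + ε)) t := by
      intro t
      have h1 : HasDerivAt (fun t => exp (K * t)) (exp (K * t) * (K * 1)) t :=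
        ((hasDerivAt_id t).const_mul K).exp
      have h2 : HasDerivAt (fun t => ‖v 0‖ + (∫ τ in 0..t, g τ) + ε * t) (g t + ε * 1) t :=
        ((hg.integral_hasStrictDerivAt 0 t).hasDerivAt.const_add _).add
          ((hasDerivAt_id t).const_mul ε)
      convert! h1.mul h2 using 1
      ring
    refine image_norm_le_of_norm_deriv_right_lt_deriv_boundary hv hv' (by simp) hB ?_
      (right_mem_Icc.2 hb)
    intro t ht hEq
    have h1 : 1 ≤ exp (K * t) := one_le_exp (mul_nonneg hK ht.1)
    have h2 := bound t ht
    rw [hEq] at h2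
    have h3 := hg0 t
    nlinarith
  have hlim : Filter.Tendsto
      (fun ε : ℝ => exp (K * b) * (‖v 0‖ + (∫ t in 0..b, g t) + ε * b))
      (nhdsWithin 0 (Ioi 0)) (nhds (exp (K * b) * (‖v 0‖ + (∫ t in 0..b, g t) + 0 * b))) :=
    Continuous.continuousWithinAt (by fun_prop)
  rw [zero_mul, add_zero] at hlim
  exact ge_of_tendsto hlim (Filter.eventually_of_mem self_mem_nhdsWithin key)

/-- Cauchy–Schwarz on an interval: the square of the `L¹` norm is bounded by the length times
the square of the `L²` norm. -/
theorem sq_intervalIntegral_norm_le {F : Type*} [NormedAddCommGroup F] {φ : ℝ → F}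
    (hφ : Continuous φ) {a b : ℝ} (hab : a < b) :
    (∫ θ in a..b, ‖φ θ‖) ^ 2 ≤ (b - a) * ∫ θ in a..b, ‖φ θ‖ ^ 2 := by
  set I := ∫ θ in a..b, ‖φ θ‖
  set J := ∫ θ in a..b, ‖φ θ‖ ^ 2
  have hc : Continuous fun θ => ‖φ θ‖ := hφ.norm
  have h0 : 0 ≤ ∫ θ in a..b, ((b - a) * ‖φ θ‖ - I) ^ 2 :=
    intervalIntegral.integral_nonneg hab.le fun _ _ => sq_nonneg _
  have h1 : ∫ θ in a..b, ((b - a) * ‖φ θ‖ - I) ^ 2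
      = (b - a) ^ 2 * J - 2 * (b - a) * I * I + (b - a) * I ^ 2 := by
    have h2 : (fun θ => ((b - a) * ‖φ θ‖ - I) ^ 2)
        = fun θ => (b - a) ^ 2 * ‖φ θ‖ ^ 2 - 2 * (b - a) * I * ‖φ θ‖ + I ^ 2 := by
      funext θ
      ring
    rw [h2, intervalIntegral.integral_add, intervalIntegral.integral_sub,
      intervalIntegral.integral_const_mul, intervalIntegral.integral_const_mul,
      intervalIntegral.integral_const, smul_eq_mul]
    all_goals exact Continuous.intervalIntegrable (by fun_prop) _ _
  rw [h1] at h0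
  have hpos : 0 < b - a := sub_pos.2 hab
  have h3 : 0 ≤ (b - a) * ((b - a) * J - I ^ 2) := by linarith
  linarith [nonneg_of_mul_nonneg_right h3 hpos]

/-- **Backward estimate (22) of Lemma 1.**  With `Y(x,φ) = ξ(h)` the endpoint of the
predictor ODE, one has `‖x‖² ≤ ρ²(‖Y(x,φ)‖² + ‖φ‖²)` with
`ρ = √2 e^{M_f h} max{1, √h (M_{B₁} + h M_int)}`. -/
theorem predictor_backward_estimate
    (n m : ℕ) (hn : 0 < n) (hm : 0 < m)
    (h : ℝ) (hh : 0 < h)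
    (Mf MB1 Mint : ℝ)
    (f : EuclideanSpace ℝ (Fin n) → EuclideanSpace ℝ (Fin n))
    (hf_cont : Continuous f)
    (hf_bound : ∀ z, ‖f z‖ ≤ Mf * ‖z‖)
    (B1 : EuclideanSpace ℝ (Fin n) → (EuclideanSpace ℝ (Fin m) →L[ℝ] EuclideanSpace ℝ (Fin n)))
    (hB1_cont : Continuous B1)
    (hB1_bound : ∀ z, ‖B1 z‖ ≤ MB1)
    (Bint : ℝ → EuclideanSpace ℝ (Fin n) →
      (EuclideanSpace ℝ (Fin m) →L[ℝ] EuclideanSpace ℝ (Fin n)))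
    (hBint_cont : ContinuousOn (fun p : ℝ × EuclideanSpace ℝ (Fin n) => Bint p.1 p.2)
      (Icc (-h) 0 ×ˢ univ))
    (hBint_bound : ∀ θ ∈ Icc (-h) 0, ∀ z, ‖Bint θ z‖ ≤ Mint)
    (φ : ℝ → EuclideanSpace ℝ (Fin m)) (hφ_cont : Continuous φ)
    (x : EuclideanSpace ℝ (Fin n))
    (ξ : ℝ → EuclideanSpace ℝ (Fin n))
    (hξ0 : ξ 0 = x)
    (hξ : ∀ s ∈ Icc 0 h, HasDerivWithinAt ξ
      (f (ξ s) + (B1 (ξ s)) (φ (s - h)) +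
        ∫ θ in (-h)..(-s), (Bint θ (ξ s)) (φ (s + θ))) (Icc 0 h) s)
    (hξC1 : ContDiffOn ℝ 1 ξ (Icc 0 h)) :
    ‖x‖ ^ 2 ≤
      (Real.sqrt 2 * Real.exp (Mf * h) * max 1 (Real.sqrt h * (MB1 + h * Mint))) ^ 2 *
        (‖ξ h‖ ^ 2 + ∫ θ in (-h)..0, ‖φ θ‖ ^ 2) := by
  have : Nonempty (Fin n) := ⟨⟨0, hn⟩⟩
  have hMf : 0 ≤ Mf := by
    obtain ⟨z, hz⟩ := exists_ne (0 : EuclideanSpace ℝ (Fin n))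
    exact nonneg_of_mul_nonneg_left ((norm_nonneg _).trans (hf_bound z)) (norm_pos_iff.2 hz)
  have hMB1 : 0 ≤ MB1 := (norm_nonneg _).trans (hB1_bound 0)
  have hMint : 0 ≤ Mint := (norm_nonneg _).trans (hBint_bound 0 (by simp [hh.le]) 0)
  set I := ∫ θ in (-h)..0, ‖φ θ‖ with hI
  set J := ∫ θ in (-h)..0, ‖φ θ‖ ^ 2
  have hI0 : 0 ≤ I := intervalIntegral.integral_nonneg (by linarith) fun _ _ => norm_nonneg _
  have hJ0 : 0 ≤ J := intervalIntegral.integral_nonneg (by linarith) fun _ _ => by positivity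
  have hIJ : I ^ 2 ≤ h * J := by
    simpa using sq_intervalIntegral_norm_le hφ_cont (neg_lt_zero.2 hh)
  have hdelay : ∀ s ∈ Icc 0 h,
      ‖∫ θ in (-h)..(-s), (Bint θ (ξ s)) (φ (s + θ))‖ ≤ Mint * I := by
    intro s hs
    have hφs : Continuous fun θ => ‖φ (s + θ)‖ := by fun_prop
    calc ‖∫ θ in (-h)..(-s), (Bint θ (ξ s)) (φ (s + θ))‖
        ≤ ∫ θ in (-h)..(-s), Mint * ‖φ (s + θ)‖ := by
          refine intervalIntegral.norm_integral_le_of_norm_le (by linarith [hs.2])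
            (Filter.Eventually.of_forall fun θ hθ => ?_)
            ((hφs.const_mul Mint).intervalIntegrable _ _)
          refine ((Bint θ (ξ s)).le_opNorm _).trans ?_
          gcongr
          exact hBint_bound θ ⟨hθ.1.le, by linarith [hθ.2, hs.1]⟩ _
      _ = Mint * ∫ θ in (s - h)..0, ‖φ θ‖ := by
          rw [intervalIntegral.integral_const_mul,
            intervalIntegral.integral_comp_add_left (fun θ => ‖φ θ‖) s]
          congr 2
          ring
      _ ≤ Mint * I := by
          gcongr
          exact intervalIntegral.integral_mono_interval (by linarith [hs.1]) (by linarith [hs.2])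
            le_rfl (Filter.Eventually.of_forall fun _ => norm_nonneg _)
            (hφ_cont.norm.intervalIntegrable _ _)
  have hmaps : MapsTo (fun t => h - t) (Icc 0 h) (Icc 0 h) := fun t ht =>
    ⟨by linarith [ht.2], by linarith [ht.1]⟩
  have hgron : ‖x‖ ≤ exp (Mf * h) * (‖ξ h‖ + (MB1 + h * Mint) * I) := by
    have hforce : Continuous fun t => MB1 * ‖φ (-t)‖ + Mint * I := by fun_prop
    have hmain := norm_le_exp_mul_add_integral_of_norm_deriv_right_le
      (v := fun t => ξ (h - t)) (g := fun t => MB1 * ‖φ (-t)‖ + Mint * I) hMf hh.le hforce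
      (fun t => by positivity)
      (hξC1.continuousOn.comp (by fun_prop) hmaps)
      (fun t ht => ((hξ (h - t) (hmaps ⟨ht.1, ht.2.le⟩)).scomp t
        ((hasDerivWithinAt_id t (Icc 0 h)).const_sub h) hmaps).mono_of_mem_nhdsWithin
          (Icc_mem_nhdsGE_of_mem ht)) ?_
    · have hint : ∫ t in 0..h, (MB1 * ‖φ (-t)‖ + Mint * I) = (MB1 + h * Mint) * I := by
        have hφn : Continuous fun t => MB1 * ‖φ (-t)‖ := by fun_prop
        rw [intervalIntegral.integral_add (hφn.intervalIntegrable _ _)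
          (continuous_const.intervalIntegrable _ _), intervalIntegral.integral_const_mul,
          intervalIntegral.integral_comp_neg (fun θ => ‖φ θ‖), intervalIntegral.integral_const,
          neg_zero, ← hI, smul_eq_mul]
        ring
      simpa [hint, hξ0] using hmain
    · intro t ht
      have hs := hmaps ⟨ht.1, ht.2.le⟩
      rw [norm_smul, norm_neg, norm_one, one_mul]
      have h1 := (B1 (ξ (h - t))).le_of_opNorm_le (hB1_bound _) (φ (h - t - h))
      rw [show h - t - h = -t by ring] at h1 ⊢
      exact (norm_add₃_le.trans
        (add_le_add (add_le_add (hf_bound _) h1) (hdelay _ hs))).trans_eq (by ring)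
  set c := MB1 + h * Mint
  have hc0 : 0 ≤ c := by positivity
  set M := max 1 (√h * c)
  have hM1 : 1 ≤ M ^ 2 := one_le_pow₀ (le_max_left _ _)
  have hM2 : h * c ^ 2 ≤ M ^ 2 := by
    rw [← sq_sqrt hh.le, ← mul_pow]
    exact pow_le_pow_left₀ (by positivity) (le_max_right _ _) 2
  have hsum : (‖ξ h‖ + c * I) ^ 2 ≤ 2 * (M ^ 2 * (‖ξ h‖ ^ 2 + J)) := by
    have h1 : (c * I) ^ 2 ≤ M ^ 2 * J := by
      calc (c * I) ^ 2 = c ^ 2 * I ^ 2 := by ring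
        _ ≤ c ^ 2 * (h * J) := by gcongr
        _ = h * c ^ 2 * J := by ring
        _ ≤ M ^ 2 * J := by gcongr
    have h2 : ‖ξ h‖ ^ 2 ≤ M ^ 2 * ‖ξ h‖ ^ 2 := le_mul_of_one_le_left (by positivity) hM1
    linarith [add_sq_le (a := ‖ξ h‖) (b := c * I)]
  calc ‖x‖ ^ 2 ≤ (exp (Mf * h) * (‖ξ h‖ + c * I)) ^ 2 := by gcongr
    _ = exp (Mf * h) ^ 2 * (‖ξ h‖ + c * I) ^ 2 := by ring
    _ ≤ exp (Mf * h) ^ 2 * (2 * (M ^ 2 * (‖ξ h‖ ^ 2 + J))) := by gcongr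
    _ = (√2 * exp (Mf * h) * M) ^ 2 * (‖ξ h‖ ^ 2 + J) := by
      rw [mul_pow, mul_pow, sq_sqrt zero_le_two]
      ring
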